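/- Let q be a complex number with |q| < 1. Then ∑_{n=0}^{∞} q^{n²} / (q; q)_n = (−q²; q²)_∞ · ∑_{n=0}^{∞} q^{n²} / ((q²; q²)_n · (−q²; q²)_n), and ∑_{n=0}^{∞} q^{n²} / (q; q)_n = (−q; q²)_∞ · ∑_{n=0}^{∞} q^{n²+n} / ((q²; q²)_n · (−q; q²)_n). -/

import Mathlib

/-- The finite q-Pochhammer symbol `(a; q)_n = ∏_{j=0}^{n-1} (1 - a q^j)`. -/
noncomputable def qPoch (a q : ℂ) (n : ℕ) : ℂ := ∏ j ∈ Finset.range n, (1 - a * q ^ j)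

/-- The infinite q-Pochhammer symbol `(a; q)_∞ = ∏_{j=0}^{∞} (1 - a q^j)`. -/
noncomputable def qPochInf (a q : ℂ) : ℂ := ∏' j : ℕ, (1 - a * q ^ j)

open Finset Filter Topology

lemma one_sub_pow_succ_ne_zero {q : ℂ} (hq : ‖q‖ < 1) (n : ℕ) : 1 - q ^ (n + 1) ≠ 0 := by
  intro h
  have h1 : ‖q ^ (n + 1)‖ < 1 := by
    rw [norm_pow]
    exact pow_lt_one₀ (norm_nonneg q) hq n.succ_ne_zero
  rw [← sub_eq_zero.mp h, norm_one] at h1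
  exact lt_irrefl _ h1

lemma norm_sq_lt_one {q : ℂ} (hq : ‖q‖ < 1) : ‖q ^ 2‖ < 1 := by
  rw [norm_pow]
  exact pow_lt_one₀ (norm_nonneg q) hq two_ne_zero

lemma qPoch_zero (a q : ℂ) : qPoch a q 0 = 1 := by simp [qPoch]

lemma qPoch_succ (a q : ℂ) (n : ℕ) : qPoch a q (n + 1) = qPoch a q n * (1 - a * q ^ n) := by
  simp [qPoch, prod_range_succ]

lemma qPoch_self_succ (q : ℂ) (n : ℕ) :
    qPoch q q (n + 1) = qPoch q q n * (1 - q ^ (n + 1)) := by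
  rw [qPoch_succ, ← pow_succ']

lemma one_sub_mul_inv_qPoch_self_succ {q : ℂ} (hq : ‖q‖ < 1) (n : ℕ) :
    (1 - q ^ (n + 1)) * (qPoch q q (n + 1))⁻¹ = (qPoch q q n)⁻¹ := by
  rw [qPoch_self_succ, mul_inv, mul_left_comm,
    mul_inv_cancel₀ (one_sub_pow_succ_ne_zero hq n), mul_one]

lemma qPoch_ne_zero {a q : ℂ} (ha : ‖a‖ < 1) (hq : ‖q‖ < 1) (n : ℕ) : qPoch a q n ≠ 0 := by
  refine prod_ne_zero_iff.mpr fun j _ h => ?_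
  have h1 : ‖a * q ^ j‖ < 1 := by
    rw [norm_mul, norm_pow]
    exact mul_lt_one_of_nonneg_of_lt_one_left (norm_nonneg a) ha
      (pow_le_one₀ (norm_nonneg q) hq.le)
  rw [← sub_eq_zero.mp h, norm_one] at h1
  exact lt_irrefl _ h1

lemma tendsto_qPoch_qPochInf (a : ℂ) {q : ℂ} (hq : ‖q‖ < 1) :
    Tendsto (qPoch a q) atTop (𝓝 (qPochInf a q)) := by
  refine Multipliable.tendsto_prod_tprod_nat (f := fun j => 1 - a * q ^ j) ?_
  simp only [sub_eq_add_neg]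
  refine multipliable_one_add_of_summable (f := fun j => -(a * q ^ j)) ?_
  simpa using (summable_geometric_of_lt_one (norm_nonneg q) hq).mul_left ‖a‖

/-- A `q`-analogue of `1 / m! = ∑ (1 / 2) ^ m / (i! j!)`:
`∑_{i+j=m} q^i / ((q²; q²)_i (q²; q²)_j) = 1 / (q; q)_m`. -/
lemma sum_antidiagonal_inv_qPoch {q : ℂ} (hq : ‖q‖ < 1) (m : ℕ) :
    ∑ x ∈ antidiagonal m,
      q ^ x.1 * ((qPoch (q ^ 2) (q ^ 2) x.1)⁻¹ * (qPoch (q ^ 2) (q ^ 2) x.2)⁻¹) =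
      (qPoch q q m)⁻¹ := by
  induction m with
  | zero => simp [qPoch_zero]
  | succ m ih =>
    set b : ℕ → ℂ := fun k => (qPoch (q ^ 2) (q ^ 2) k)⁻¹
    have hrec (k : ℕ) : (1 - (q ^ 2) ^ (k + 1)) * b (k + 1) = b k :=
      one_sub_mul_inv_qPoch_self_succ (norm_sq_lt_one hq) k
    change ∑ x ∈ antidiagonal m, q ^ x.1 * (b x.1 * b x.2) = _ at ih
    change ∑ x ∈ antidiagonal (m + 1), q ^ x.1 * (b x.1 * b x.2) = _
    have hmul : (1 - q ^ (m + 1)) * ∑ x ∈ antidiagonal (m + 1), q ^ x.1 * (b x.1 * b x.2) =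
        ∑ x ∈ antidiagonal m, q ^ x.1 * (b x.1 * b x.2) := by
      have h1 : q ^ (m + 1) * ∑ x ∈ antidiagonal (m + 1), q ^ x.1 * (b x.1 * b x.2) =
          ∑ x ∈ antidiagonal (m + 1), q ^ x.2 * (b x.2 * ((q ^ 2) ^ x.1 * b x.1)) := by
        rw [mul_sum]
        refine sum_congr rfl fun x hx => ?_
        rw [← mem_antidiagonal.mp hx]
        ring
      rw [sub_mul, one_mul, h1, ← Nat.sum_antidiagonal_swap, ← sum_sub_distrib,
        Nat.sum_antidiagonal_succ,
        ← Nat.sum_antidiagonal_swap (n := m) (f := fun x => q ^ x.1 * (b x.1 * b x.2))]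
      simp only [Prod.fst_swap, Prod.snd_swap, pow_zero, one_mul, sub_self, zero_add]
      refine sum_congr rfl fun x _ => ?_
      rw [← hrec x.1]
      ring
    have hne := one_sub_pow_succ_ne_zero hq m
    rw [← mul_right_inj' hne, hmul, ih, one_sub_mul_inv_qPoch_self_succ hq]

/-- The terms of Euler's expansion of `(-wq; q²)_∞` in powers of `w`. -/
noncomputable def eulerTerm (q w : ℂ) (k : ℕ) : ℂ :=
  w ^ k * q ^ k ^ 2 * (qPoch (q ^ 2) (q ^ 2) k)⁻¹

lemma eulerTerm_zero (q w : ℂ) : eulerTerm q w 0 = 1 := by simp [eulerTerm, qPoch_zero]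

lemma eulerTerm_mul (q w c : ℂ) (k : ℕ) : eulerTerm q (c * w) k = c ^ k * eulerTerm q w k := by
  simp only [eulerTerm, mul_pow, mul_assoc]

lemma eulerTerm_succ {q : ℂ} (hq : ‖q‖ < 1) (w : ℂ) (k : ℕ) :
    (1 - (q ^ 2) ^ (k + 1)) * eulerTerm q w (k + 1) =
      w * q * (q ^ 2) ^ k * eulerTerm q w k := by
  simp only [eulerTerm]
  rw [← one_sub_mul_inv_qPoch_self_succ (norm_sq_lt_one hq) k]
  ring

lemma summable_norm_eulerTerm {q : ℂ} (hq : ‖q‖ < 1) (w : ℂ) :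
    Summable fun k => ‖eulerTerm q w k‖ := by
  have hq2 := norm_sq_lt_one hq
  have hpow := tendsto_pow_atTop_nhds_zero_of_norm_lt_one hq2
  have hlim : Tendsto (fun k : ℕ => w * q * (q ^ 2) ^ k / (1 - (q ^ 2) ^ (k + 1)))
      atTop (𝓝 (w * q * 0 / (1 - 0))) :=
    (hpow.const_mul _).div (tendsto_const_nhds.sub ((tendsto_add_atTop_iff_nat 1).mpr hpow))
      (by simp)
  have hlim' := hlim.norm
  rw [mul_zero, zero_div, norm_zero] at hlim'
  refine summable_of_ratio_norm_eventually_le (r := 1 / 2) (by norm_num) ?_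
  filter_upwards [hlim'.eventually_le_const (show (0 : ℝ) < 1 / 2 by norm_num)] with k hk
  have hne := one_sub_pow_succ_ne_zero hq2 k
  have hstep : eulerTerm q w (k + 1) =
      w * q * (q ^ 2) ^ k / (1 - (q ^ 2) ^ (k + 1)) * eulerTerm q w k := by
    rw [div_mul_eq_mul_div, eq_div_iff hne, mul_comm, eulerTerm_succ hq]
  rw [norm_norm, norm_norm, hstep, norm_mul]
  exact mul_le_mul_of_nonneg_right hk (norm_nonneg _)

lemma summable_eulerTerm {q : ℂ} (hq : ‖q‖ < 1) (w : ℂ) : Summable (eulerTerm q w) :=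
  (summable_norm_eulerTerm hq w).of_norm

lemma tsum_eulerTerm_eq_mul {q : ℂ} (hq : ‖q‖ < 1) (w : ℂ) :
    ∑' k, eulerTerm q w k = (1 + w * q) * ∑' k, eulerTerm q (q ^ 2 * w) k := by
  have hs := summable_eulerTerm hq w
  have hs' := summable_eulerTerm hq (q ^ 2 * w)
  have hdiff : ∑' k, eulerTerm q w k - ∑' k, eulerTerm q (q ^ 2 * w) k =
      w * q * ∑' k, eulerTerm q (q ^ 2 * w) k := by
    rw [← hs.tsum_sub hs', (hs.sub hs').tsum_eq_zero_add, ← tsum_mul_left,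
      eulerTerm_zero, eulerTerm_zero, sub_self, zero_add]
    refine tsum_congr fun k => ?_
    rw [eulerTerm_mul, eulerTerm_mul, ← mul_assoc, ← eulerTerm_succ hq]
    ring
  linear_combination hdiff

lemma tsum_eulerTerm_eq_qPoch_mul {q : ℂ} (hq : ‖q‖ < 1) (w : ℂ) (n : ℕ) :
    ∑' k, eulerTerm q w k =
      qPoch (-(w * q)) (q ^ 2) n * ∑' k, eulerTerm q ((q ^ 2) ^ n * w) k := by
  induction n with
  | zero => simp [qPoch_zero]
  | succ n ih =>
    rw [ih, tsum_eulerTerm_eq_mul hq, qPoch_succ, ← mul_assoc (q ^ 2), ← pow_succ']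
    ring

/-- Euler's identity `∑ w^k q^{k²} / (q²; q²)_k = (-wq; q²)_∞`. -/
lemma tsum_eulerTerm {q : ℂ} (hq : ‖q‖ < 1) (w : ℂ) :
    ∑' k, eulerTerm q w k = qPochInf (-(w * q)) (q ^ 2) := by
  have hq2 := norm_sq_lt_one hq
  have htail : Tendsto (fun n : ℕ => ∑' k, eulerTerm q ((q ^ 2) ^ n * w) k) atTop (𝓝 1) := by
    have h0 : ∑' k, eulerTerm q (0 * w) k = 1 := by
      rw [tsum_eq_single 0 fun k hk => by rw [eulerTerm_mul, zero_pow hk, zero_mul],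
        eulerTerm_zero]
    rw [← h0]
    refine tendsto_tsum_of_dominated_convergence (summable_norm_eulerTerm hq w) (fun k => ?_)
      (Eventually.of_forall fun n k => ?_)
    · simp only [eulerTerm_mul]
      exact ((tendsto_pow_atTop_nhds_zero_of_norm_lt_one hq2).pow k).mul_const _
    · rw [eulerTerm_mul, norm_mul, norm_pow, norm_pow]
      exact mul_le_of_le_one_left (norm_nonneg _)
        (pow_le_one₀ (by positivity) (pow_le_one₀ (norm_nonneg _) hq2.le))
  have hlim := (tendsto_qPoch_qPochInf (-(w * q)) hq2).mul htail
  simp only [← tsum_eulerTerm_eq_qPoch_mul hq w, mul_one] at hlim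
  exact tendsto_nhds_unique tendsto_const_nhds hlim

lemma tsum_tsum_eq_tsum_sum_antidiagonal {f : ℕ × ℕ → ℂ} (hf : Summable f) :
    ∑' n, ∑' k, f (n, k) = ∑' m, ∑ x ∈ antidiagonal m, f x := by
  rw [← hf.tsum_prod, ← HasAntidiagonal.sigmaAntidiagonalEquivProd.tsum_eq f]
  refine (HasAntidiagonal.sigmaAntidiagonalEquivProd.summable_iff.mpr hf).tsum_sigma.trans
    (tsum_congr fun m => ?_)
  rw [tsum_fintype]
  exact sum_coe_sort (antidiagonal m) f

lemma qPochInf_mul_tsum {q s t : ℂ} (hq : ‖q‖ < 1) (hs : ‖s‖ ≤ 1) :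
    qPochInf (-(s * q)) (q ^ 2) *
      ∑' n : ℕ, t ^ n * q ^ n ^ 2 / (qPoch (q ^ 2) (q ^ 2) n * qPoch (-(s * q)) (q ^ 2) n) =
    ∑' m : ℕ, q ^ m ^ 2 * ∑ x ∈ antidiagonal m, t ^ x.1 * s ^ x.2 *
      ((qPoch (q ^ 2) (q ^ 2) x.1)⁻¹ * (qPoch (q ^ 2) (q ^ 2) x.2)⁻¹) := by
  have hsq : ‖-(s * q)‖ < 1 := by
    rw [norm_neg, norm_mul]
    exact mul_lt_one_of_nonneg_of_lt_one_right hs (norm_nonneg q) hq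
  set f : ℕ × ℕ → ℂ := fun x => q ^ (x.1 + x.2) ^ 2 * (t ^ x.1 * s ^ x.2 *
    ((qPoch (q ^ 2) (q ^ 2) x.1)⁻¹ * (qPoch (q ^ 2) (q ^ 2) x.2)⁻¹)) with hf
  have hfe (n k : ℕ) : f (n, k) = eulerTerm q t n * eulerTerm q ((q ^ 2) ^ n * s) k := by
    simp only [hf, eulerTerm]
    ring
  have hfs : Summable f := by
    refine Summable.of_norm_bounded (g := fun x => ‖eulerTerm q t x.1 * eulerTerm q s x.2‖)
      (summable_mul_of_summable_norm (summable_norm_eulerTerm hq t)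
        (summable_norm_eulerTerm hq s)).norm fun ⟨n, k⟩ => ?_
    rw [hfe, eulerTerm_mul, norm_mul, norm_mul, norm_mul, norm_pow, norm_pow]
    refine mul_le_mul_of_nonneg_left (mul_le_of_le_one_left (norm_nonneg _) ?_) (norm_nonneg _)
    exact pow_le_one₀ (by positivity) (pow_le_one₀ (norm_nonneg _) (norm_sq_lt_one hq).le)
  calc
    _ = ∑' n, ∑' k, f (n, k) := by
      rw [← tsum_mul_left]
      refine tsum_congr fun n => ?_
      have hne := qPoch_ne_zero hsq (norm_sq_lt_one hq) n
      simp only [hfe]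
      rw [tsum_mul_left, ← tsum_eulerTerm hq, tsum_eulerTerm_eq_qPoch_mul hq s n, eulerTerm]
      field_simp
    _ = ∑' m, ∑ x ∈ antidiagonal m, f x := tsum_tsum_eq_tsum_sum_antidiagonal hfs
    _ = _ := by
      refine tsum_congr fun m => ?_
      rw [mul_sum]
      refine sum_congr rfl fun x hx => ?_
      rw [← mem_antidiagonal.mp hx]

/-- equality of the left sides of S18, S20 and S99: for `|q| < 1`,
`∑_{n≥0} q^{n²}/(q; q)_n = (−q²; q²)_∞ ∑_{n≥0} q^{n²}/((q²; q²)_n (−q²; q²)_n)` and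
`∑_{n≥0} q^{n²}/(q; q)_n
  = (−q; q²)_∞ ∑_{n≥0} q^{n²+n}/((q²; q²)_n (−q; q²)_n)`. -/
theorem slater_S18_S20_S99 (q : ℂ) (hq : ‖q‖ < 1) :
    (∑' n : ℕ, q ^ (n ^ 2) / qPoch q q n =
      qPochInf (-q ^ 2) (q ^ 2) *
        ∑' n : ℕ, q ^ (n ^ 2) /
          (qPoch (q ^ 2) (q ^ 2) n * qPoch (-q ^ 2) (q ^ 2) n)) ∧
    (∑' n : ℕ, q ^ (n ^ 2) / qPoch q q n =
      qPochInf (-q) (q ^ 2) *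
        ∑' n : ℕ, q ^ (n ^ 2 + n) /
          (qPoch (q ^ 2) (q ^ 2) n * qPoch (-q) (q ^ 2) n)) := by
  constructor
  · have h := qPochInf_mul_tsum (t := 1) hq hq.le
    simp only [one_pow, one_mul, ← sq] at h
    rw [h]
    refine tsum_congr fun m => ?_
    rw [div_eq_mul_inv, ← sum_antidiagonal_inv_qPoch hq, ← Nat.sum_antidiagonal_swap]
    congr 1
    refine sum_congr rfl fun x _ => ?_
    rw [Prod.fst_swap, Prod.snd_swap, mul_comm (qPoch _ _ _)⁻¹]
  · have h := qPochInf_mul_tsum (t := q) hq norm_one.le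
    simp only [one_pow, one_mul, mul_one, ← pow_add, add_comm _ (_ ^ 2)] at h
    rw [h]
    refine tsum_congr fun m => ?_
    rw [div_eq_mul_inv, ← sum_antidiagonal_inv_qPoch hq]
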